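/- arXiv:1306.6805 — 6 statements merged into one kernel-verified Lean document; each statement's English description precedes it below -/
import Mathlib

section
/- Let α be a type with decidable equality, let f : Finset α → ℤ be a support function on itemsets, let p_s be a fixed itemset, and let Δ be an integer. Define the sanitized support function f' by f'(X) = f(X) + Δ if X ⊆ p_s and f'(X) = f(X) otherwise. Then for all itemsets I ⊆ J: C(f', I, J) = C(f, I, J) + Δ if I ⊆ p_s and J ∩ p_s = I, and C(f', I, J) = C(f, I, J) otherwise. -/
/-- The inference-channel value `C(f, I, J) = ∑_{I ⊆ X ⊆ J} (-1)^{|X \ I|} · f(X)`. -/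
def channelValue {α : Type*} [DecidableEq α] (f : Finset α → ℤ) (I J : Finset α) : ℤ :=
  ∑ X ∈ Finset.Icc I J, (-1 : ℤ) ^ (X \ I).card * f X

theorem sum_Icc_neg_one_pow_card_sdiff {α : Type*} [DecidableEq α] (I K : Finset α) :
    ∑ X ∈ Finset.Icc I K, (-1 : ℤ) ^ (X \ I).card = if I = K then 1 else 0 := by
  by_cases h : I ⊆ K
  · have hdisj : ∀ Y ∈ (K \ I).powerset, Disjoint Y I := fun Y hY =>
      Finset.disjoint_of_subset_left (Finset.mem_powerset.mp hY) Finset.sdiff_disjoint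
    rw [Finset.Icc_eq_image_powerset h, Finset.sum_image]
    · have hsum : ∑ Y ∈ (K \ I).powerset, (-1 : ℤ) ^ ((I ∪ Y) \ I).card =
          ∑ Y ∈ (K \ I).powerset, (-1 : ℤ) ^ Y.card :=
        Finset.sum_congr rfl fun Y hY => by
          rw [Finset.union_sdiff_cancel_left (hdisj Y hY).symm]
      rw [hsum, Finset.sum_powerset_neg_one_pow_card]
      refine if_congr ?_ rfl rfl
      rw [Finset.sdiff_eq_empty_iff_subset]
      exact ⟨fun h' => h.antisymm h', fun h' => h'.ge⟩
    · intro Y hY Z hZ hYZ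
      have hYZ' : I ∪ Y = I ∪ Z := hYZ
      rw [← Finset.union_sdiff_cancel_left (hdisj Y hY).symm, hYZ',
        Finset.union_sdiff_cancel_left (hdisj Z hZ).symm]
  · rw [Finset.Icc_eq_empty h, Finset.sum_empty, if_neg fun h' => h h'.le]

theorem filter_subset_Icc {α : Type*} [DecidableEq α] (I J S : Finset α) :
    (Finset.Icc I J).filter (· ⊆ S) = Finset.Icc I (J ∩ S) := by
  ext X
  simp only [Finset.mem_filter, Finset.mem_Icc, Finset.subset_inter_iff,
    and_assoc]

/-- Effect of the additive pattern sanitization (adding `Δ` to the support of `p_s`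
and of all its subsets) on inference-channel values. -/
theorem sanitized_channelValue {α : Type*} [DecidableEq α]
    (f : Finset α → ℤ) (ps : Finset α) (Δ : ℤ)
    (f' : Finset α → ℤ) (hf' : ∀ X, f' X = if X ⊆ ps then f X + Δ else f X)
    (I J : Finset α) (hIJ : I ⊆ J) :
    channelValue f' I J =
      if I ⊆ ps ∧ J ∩ ps = I then channelValue f I J + Δ else channelValue f I J := by
  have hsum : channelValue f' I J =
      channelValue f I J + (if I = J ∩ ps then 1 else 0) * Δ := by
    rw [← sum_Icc_neg_one_pow_card_sdiff, ← filter_subset_Icc, Finset.sum_filter,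
      Finset.sum_mul, channelValue, channelValue, ← Finset.sum_add_distrib]
    refine Finset.sum_congr rfl fun X _ => ?_
    rw [hf' X]
    split_ifs <;> ring
  have hiff : (I ⊆ ps ∧ J ∩ ps = I) ↔ I = J ∩ ps :=
    ⟨fun h => h.2.symm, fun h => ⟨h ▸ Finset.inter_subset_right, h.symm⟩⟩
  rw [hsum, if_congr hiff rfl rfl]
  split_ifs <;> ring
end

section
/- Let s be a nonempty finite set of indices of a type ι, let π : ι → κ be a grouping map (assigning each fine-grained group to the coarser group generalizing it), and for each i ∈ s let a_i > 0 and b_i > 0 be real numbers (the supports supp(A^i ∪ B ∪ C) and supp(A^i ∪ B) of the fine-grained rules). Let α be a real number and suppose that for all i, j ∈ s, a_i / b_i < α · (a_j / b_j). For each t in the image π(s), set A_t = Σ_{i ∈ s, π(i) = t} a_i and B_t = Σ_{i ∈ s, π(i) = t} b_i. Then for all t, u in the image π(s), A_t / B_t < α · (A_u / B_u). -/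
/-- A strict bound between all pairs of ratios passes to the ratios of sums. -/
theorem Finset.sum_div_sum_lt_mul_sum_div_sum {ι κ 𝕜 : Type*}
    [Field 𝕜] [LinearOrder 𝕜] [IsStrictOrderedRing 𝕜]
    {s : Finset ι} {t : Finset κ} (hs : s.Nonempty) (ht : t.Nonempty)
    {a b : ι → 𝕜} {c d : κ → 𝕜} {α : 𝕜}
    (hb : ∀ i ∈ s, 0 < b i) (hd : ∀ j ∈ t, 0 < d j)
    (h : ∀ i ∈ s, ∀ j ∈ t, a i / b i < α * (c j / d j)) :
    (∑ i ∈ s, a i) / (∑ i ∈ s, b i) < α * ((∑ j ∈ t, c j) / (∑ j ∈ t, d j)) := by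
  rw [← mul_div_assoc, div_lt_div_iff₀ (Finset.sum_pos hb hs) (Finset.sum_pos hd ht),
    Finset.mul_sum t c α, Finset.sum_mul_sum s t, Finset.sum_mul_sum t s,
    Finset.sum_comm (s := t)]
  refine Finset.sum_lt_sum_of_nonempty hs fun i hi ↦
    Finset.sum_lt_sum_of_nonempty ht fun j hj ↦ ?_
  have hij := h i hi j hj
  rwa [← mul_div_assoc, div_lt_div_iff₀ (hb i hi) (hd j hj)] at hij

/-- Generalization property of α-protection for the measure `clift`: if every pair of
fine-grained groups satisfies `aᵢ/bᵢ < α · (aⱼ/bⱼ)`, then after merging groups along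
the generalization map `π`, every pair of coarse groups satisfies the same bound. -/
theorem clift_generalization_property {ι κ : Type*} [DecidableEq κ]
    (s : Finset ι) (hs : s.Nonempty) (π : ι → κ)
    (a b : ι → ℝ) (ha : ∀ i ∈ s, 0 < a i) (hb : ∀ i ∈ s, 0 < b i)
    (α : ℝ)
    (h : ∀ i ∈ s, ∀ j ∈ s, a i / b i < α * (a j / b j)) :
    ∀ t ∈ s.image π, ∀ u ∈ s.image π,
      (∑ i ∈ s.filter (fun i => π i = t), a i) /
          (∑ i ∈ s.filter (fun i => π i = t), b i) <
        α * ((∑ i ∈ s.filter (fun i => π i = u), a i) /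
          (∑ i ∈ s.filter (fun i => π i = u), b i)) := by
  intro t ht u hu
  have fiber_nonempty : ∀ v ∈ s.image π, (s.filter (fun i => π i = v)).Nonempty := by
    intro v hv
    obtain ⟨i, hi, hiv⟩ := Finset.mem_image.mp hv
    exact ⟨i, Finset.mem_filter.mpr ⟨hi, hiv⟩⟩
  exact Finset.sum_div_sum_lt_mul_sum_div_sum (fiber_nonempty t ht) (fiber_nonempty u hu)
    (fun i hi ↦ hb i (Finset.mem_of_mem_filter i hi))
    (fun j hj ↦ hb j (Finset.mem_of_mem_filter j hj))
    (fun i hi j hj ↦ h i (Finset.mem_of_mem_filter i hi) j (Finset.mem_of_mem_filter j hj))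
end

section
/- Let a1 > 0, n1 > 0, b > 0, bc ≥ 0, and α be real numbers with a1 < α · n1, and let Δ be a real number with b + Δ > 0 and Δ > (α · n1 · bc − a1 · b) / (a1 − α · n1). Then bc + Δ > 0 and a1 · (b + Δ) < α · n1 · (bc + Δ); equivalently, (a1 / n1) / ((bc + Δ) / (b + Δ)) < α. -/
/-- Correctness of anti-discrimination pattern sanitization for `elift`: increasing
the supports `b = supp(B)` and `bc = supp(B,C)` by any `Δ` exceeding
`(α·n1·bc − a1·b)/(a1 − α·n1)` makes the extended lift strictly less than `α`. -/
theorem elift_sanitization_correct (a1 n1 b bc α Δ : ℝ)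
    (ha1 : 0 < a1) (hn1 : 0 < n1) (hb : 0 < b) (hbc : 0 ≤ bc)
    (h1 : a1 < α * n1) (hbΔ : 0 < b + Δ)
    (hΔ : (α * n1 * bc - a1 * b) / (a1 - α * n1) < Δ) :
    0 < bc + Δ ∧ a1 * (b + Δ) < α * n1 * (bc + Δ) ∧
      (a1 / n1) / ((bc + Δ) / (b + Δ)) < α := by
  have hlt : a1 * (b + Δ) < α * n1 * (bc + Δ) := by
    rw [div_lt_iff_of_neg (sub_neg.mpr h1)] at hΔ
    linarith
  have hpos : 0 < bc + Δ :=
    pos_of_mul_pos_right ((mul_pos ha1 hbΔ).trans hlt) (ha1.trans h1).le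
  refine ⟨hpos, hlt, ?_⟩
  rwa [div_div_div_eq, div_lt_iff₀ (mul_pos hn1 hpos), ← mul_assoc]
end

section
/- Let D be a type of databases with an adjacency relation Adj on D, let ε1, ε2 be real numbers, let M1 : D → PMF Ω1 be an ε1-differentially private randomized mechanism and M2 : D → PMF Ω2 an ε2-differentially private randomized mechanism. Define the sequential composition M : D → PMF (Ω1 × Ω2) by sampling ω1 from M1 d and, independently, ω2 from M2 d, and outputting (ω1, ω2), i.e., M d = (M1 d).bind (fun ω1 => (M2 d).map (fun ω2 => (ω1, ω2))). Then M is (ε1 + ε2)-differentially private. -/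
/-- A randomized mechanism `M : D → PMF Ω` is `ε`-differentially private w.r.t. an
adjacency relation `Adj` if for all adjacent databases and every set of outcomes,
the probability under `M d` is at most `exp ε` times the probability under `M d'`. -/
def DiffPrivate {D Ω : Type*} (Adj : D → D → Prop) (ε : ℝ) (M : D → PMF Ω) : Prop :=
  ∀ d d', Adj d d' → ∀ S : Set Ω,
    (M d).toOuterMeasure S ≤ ENNReal.ofReal (Real.exp ε) * (M d').toOuterMeasure S

theorem DiffPrivate.apply_le {D Ω : Type*} {Adj : D → D → Prop} {ε : ℝ} {M : D → PMF Ω}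
    (h : DiffPrivate Adj ε M) {d d' : D} (hd : Adj d d') (ω : Ω) :
    M d ω ≤ ENNReal.ofReal (Real.exp ε) * M d' ω := by
  simpa only [PMF.toOuterMeasure_apply_singleton] using h d d' hd {ω}

/-- Sequential composition of differential privacy: running an `ε1`-DP mechanism and,
independently, an `ε2`-DP mechanism on the same database and outputting the pair is
`(ε1 + ε2)`-differentially private. -/
theorem diffPrivate_composition {D Ω1 Ω2 : Type*} (Adj : D → D → Prop) (ε1 ε2 : ℝ)
    (M1 : D → PMF Ω1) (M2 : D → PMF Ω2)
    (h1 : DiffPrivate Adj ε1 M1) (h2 : DiffPrivate Adj ε2 M2) :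
    DiffPrivate Adj (ε1 + ε2)
      (fun d => (M1 d).bind fun ω1 => (M2 d).map fun ω2 => (ω1, ω2)) := by
  intro d d' hd S
  simp only [PMF.toOuterMeasure_bind_apply, PMF.toOuterMeasure_map_apply]
  rw [← ENNReal.tsum_mul_left]
  refine ENNReal.tsum_le_tsum fun ω1 => ?_
  rw [Real.exp_add, ENNReal.ofReal_mul (Real.exp_nonneg _), mul_mul_mul_comm]
  exact mul_le_mul' (h1.apply_le hd ω1) (h2 d d' hd _)
end

section
/- Let a database be a multiset of records over a finite attribute set, each record being a function r : ι → V, let k be a natural number, and let Q be a finite set of attributes. Let g : ι → V → V assign to each attribute a (many-to-one) value-generalization function, and let D' be the generalized database obtained from D by replacing each record r with the record i ↦ g i (r i). If D is k-anonymous with respect to Q, then D' is k-anonymous with respect to Q. -/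
/-- A database (multiset of records) is `k`-anonymous w.r.t. a finite set `Q` of
attributes if every record agrees on all attributes in `Q` with at least `k`
records of the database (counted with multiplicity). -/
def kAnonymous {ι V : Type*} [DecidableEq V]
    (k : ℕ) (D : Multiset (ι → V)) (Q : Finset ι) : Prop :=
  ∀ r ∈ D, k ≤ Multiset.card (D.filter (fun r' => ∀ i ∈ Q, r' i = r i))

/-- Generalization property of `k`-anonymity: replacing each attribute value by its
generalization (via the per-attribute value-generalization functions `g i`)
preserves `k`-anonymity w.r.t. `Q`. -/
theorem kAnonymous_generalization {ι V : Type*} [DecidableEq V]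
    (k : ℕ) (D : Multiset (ι → V)) (Q : Finset ι) (g : ι → V → V)
    (h : kAnonymous k D Q) :
    kAnonymous k (D.map (fun r => fun i => g i (r i))) Q := by
  intro s hs
  obtain ⟨r, hr, rfl⟩ := Multiset.mem_map.mp hs
  rw [Multiset.filter_map, Multiset.card_map]
  refine (h r hr).trans (Multiset.card_le_card (Multiset.monotone_filter_right D ?_))
  exact fun r' hr' i hi => congrArg (g i) (hr' i hi)
end

section
/- Let a ≥ 0, n > 0, 0 < bc ≤ b, Δ ≥ 0 and α be real numbers. If (a / n) / (bc / b) < α, then (a / n) / ((bc + Δ) / (b + Δ)) < α. -/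
/-- Anti-discrimination pattern sanitization for `elift` does not generate new
discrimination: if `(a/n)/(bc/b) < α` with `0 < bc ≤ b`, then adding the same
`Δ ≥ 0` to `bc` and `b` keeps the extended lift below `α`. -/
theorem elift_sanitization_no_new_discrimination (a n bc b Δ α : ℝ)
    (ha : 0 ≤ a) (hn : 0 < n) (hbc : 0 < bc) (hbcb : bc ≤ b) (hΔ : 0 ≤ Δ)
    (h : (a / n) / (bc / b) < α) :
    (a / n) / ((bc + Δ) / (b + Δ)) < α := by
  have hb : 0 < b := hbc.trans_le hbcb
  have hconf : bc / b ≤ (bc + Δ) / (b + Δ) := by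
    rw [div_le_div_iff₀ hb (by positivity)]
    nlinarith [mul_le_mul_of_nonneg_right hbcb hΔ]
  exact (div_le_div_of_nonneg_left (by positivity) (by positivity) hconf).trans_lt h
end
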